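/- Let $n\ge 1$ be an integer and let $a_0>0$ and $a_1,b_0,b_1$ be real numbers. Let $w,\chi:\mathbb{Z}_{>0}\to\mathbb{R}$ satisfy $w(r)=b_0 r^{n+1}+b_1 r^{n}+O(r^{n-1})$ and $\chi(r)=a_0 r^{n}+a_1 r^{n-1}+O(r^{n-2})$ as $r\to\infty$, and let $(b_0^{(r)})_{r\in\mathbb{Z}_{>0}}$ be a sequence of real numbers with $b_0^{(r)}\le b_0$ for all $r$. Then $\liminf_{r\to\infty} 2\left(\frac{r\,b_0^{(r)}}{a_0}-\frac{w(r)}{\chi(r)}\right)\;\le\;\frac{2(b_0 a_1-b_1 a_0)}{a_0^{2}}$. -/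

import Mathlib

open Filter

open Topology in
theorem tendsto_zero_of_eventually_abs_le_mul_inv {f : ℕ → ℝ} {C : ℝ}
    (h : ∀ᶠ r : ℕ in atTop, |f r| ≤ C * (r : ℝ)⁻¹) : Tendsto f atTop (𝓝 0) := by
  refine squeeze_zero_norm' h ?_
  simpa using (tendsto_inv_atTop_nhds_zero_nat (𝕜 := ℝ)).const_mul C

open Topology in
/-- A two-term expansion with leading exponent `k` determines the second coefficient. -/
theorem tendsto_second_coeff {f : ℕ → ℝ} {a b : ℝ} {k : ℤ}
    (h : ∃ C : ℝ, ∀ᶠ r : ℕ in atTop,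
      |f r - (a * (r : ℝ) ^ k + b * (r : ℝ) ^ (k - 1))| ≤ C * (r : ℝ) ^ (k - 2)) :
    Tendsto (fun r : ℕ => r * (f r / (r : ℝ) ^ k - a)) atTop (𝓝 b) := by
  obtain ⟨C, hC⟩ := h
  refine tendsto_sub_nhds_zero_iff.mp
    (tendsto_zero_of_eventually_abs_le_mul_inv (C := C) ?_)
  filter_upwards [hC, eventually_gt_atTop 0] with r hr hr0
  have hpos : (0 : ℝ) < r := by exact_mod_cast hr0
  have hk : (0 : ℝ) < (r : ℝ) ^ k := zpow_pos hpos k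
  have hk1 : (r : ℝ) ^ (k - 1) = (r : ℝ) ^ k / r := zpow_sub_one₀ hpos.ne' k
  have hk2 : (r : ℝ) ^ (k - 2) = (r : ℝ) ^ k / r ^ 2 := by
    rw [zpow_sub₀ hpos.ne']; norm_cast
  rw [hk1, hk2] at hr
  have key : r * (f r / (r : ℝ) ^ k - a) - b
      = (f r - (a * (r : ℝ) ^ k + b * ((r : ℝ) ^ k / r))) * (r / (r : ℝ) ^ k) := by
    field_simp
    ring
  rw [key, abs_mul, abs_of_pos (div_pos hpos hk)]
  refine (mul_le_mul_of_nonneg_right hr (div_pos hpos hk).le).trans_eq ?_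
  field_simp

/-- If `w(r) = b₀ r^{n+1} + b₁ r^n + O(r^{n-1})`,
`χ(r) = a₀ r^n + a₁ r^{n-1} + O(r^{n-2})` with `a₀ > 0`, and `b₀⁽ʳ⁾ ≤ b₀` for all `r`,
then `liminf_r 2 (r b₀⁽ʳ⁾ / a₀ - w(r)/χ(r)) ≤ 2 (b₀ a₁ - b₁ a₀)/a₀²`
(the liminf is taken in the extended reals so that it is always well defined). -/
theorem liminf_chow_le_DF
    (n : ℕ) (hn : 1 ≤ n) (a0 a1 b0 b1 : ℝ) (ha0 : 0 < a0)
    (w χ : ℕ → ℝ) (b0seq : ℕ → ℝ) (hb0seq : ∀ r, b0seq r ≤ b0)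
    (hw : ∃ Cw : ℝ, ∀ᶠ r : ℕ in atTop,
      |w r - (b0 * (r : ℝ) ^ ((n : ℤ) + 1) + b1 * (r : ℝ) ^ (n : ℤ))|
        ≤ Cw * (r : ℝ) ^ ((n : ℤ) - 1))
    (hχ : ∃ Cχ : ℝ, ∀ᶠ r : ℕ in atTop,
      |χ r - (a0 * (r : ℝ) ^ (n : ℤ) + a1 * (r : ℝ) ^ ((n : ℤ) - 1))|
        ≤ Cχ * (r : ℝ) ^ ((n : ℤ) - 2)) :
    liminf (fun r : ℕ =>
        ((2 * ((r : ℝ) * b0seq r / a0 - w r / χ r) : ℝ) : EReal)) atTop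
      ≤ ((2 * (b0 * a1 - b1 * a0) / a0 ^ 2 : ℝ) : EReal) := by
  have hp : Tendsto (fun r : ℕ => r * (w r / (r : ℝ) ^ ((n : ℤ) + 1) - b0)) atTop (nhds b1) := by
    refine tendsto_second_coeff ?_
    rwa [add_sub_cancel_right, show (n : ℤ) + 1 - 2 = n - 1 by ring]
  have hq : Tendsto (fun r : ℕ => r * (χ r / (r : ℝ) ^ (n : ℤ) - a0)) atTop (nhds a1) :=
    tendsto_second_coeff hχ
  have hc : Tendsto (fun r : ℕ => χ r / (r : ℝ) ^ (n : ℤ)) atTop (nhds a0) := by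
    have h := ((tendsto_inv_atTop_nhds_zero_nat (𝕜 := ℝ)).mul hq).add_const a0
    rw [zero_mul, zero_add] at h
    refine h.congr' ?_
    filter_upwards [eventually_gt_atTop 0] with r hr0
    have hpos : (r : ℝ) ≠ 0 := by exact_mod_cast hr0.ne'
    rw [inv_mul_cancel_left₀ hpos, sub_add_cancel]
  have hlim : Tendsto (fun r : ℕ => 2 * ((r : ℝ) * b0 / a0 - w r / χ r)) atTop
      (nhds (2 * (b0 * a1 - b1 * a0) / a0 ^ 2)) := by
    have h := (((hq.const_mul b0).sub (hp.mul_const a0)).const_mul 2).div (hc.const_mul a0)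
      (mul_pos ha0 ha0).ne'
    rw [← sq] at h
    refine h.congr' ?_
    filter_upwards [eventually_gt_atTop 0, hc.eventually_const_lt ha0] with r hr0 hcr
    have hpos : (0 : ℝ) < r := by exact_mod_cast hr0
    have hk : (0 : ℝ) < (r : ℝ) ^ (n : ℤ) := zpow_pos hpos _
    have hχr : χ r ≠ 0 := by
      rintro h0
      simp [h0] at hcr
    simp only [Pi.div_apply, zpow_add_one₀ hpos.ne']
    generalize (r : ℝ) ^ (n : ℤ) = x at hk
    field_simp
    ring
  rw [← ((continuous_coe_real_ereal.tendsto _).comp hlim).liminf_eq]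
  refine liminf_le_liminf (Eventually.of_forall fun r => ?_)
  simp only [Function.comp_apply, EReal.coe_le_coe_iff]
  have := hb0seq r
  gcongr
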